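/- arXiv:2408.03343 — 6 statements merged into one kernel-verified Lean document; each statement's English description precedes it below -/
import Mathlib

section
/- Let h > 0, let a ≥ 0, c > 0, B₀ > 0, K > 0, C > 0, A < 0, and let q be a real number. Set s₊ = √(−2A/C). Then for every C¹ function Q : [0,h] → ℝ and every C² function u : [0,h] → ℝ, the one-dimensional energy E₁D(Q,u) = ∫₀ʰ [ (a/2)u² + (c/4)u⁴ + B₀·(u″ + q²(Q/s₊ + 1/2)u)² + K·(Q′)² + A·Q² + C·Q⁴ ] dx satisfies E₁D(Q,u) ≥ −h·A²/(4C). Moreover, equality holds for the nematic phase Q ≡ √(−A/(2C)), u ≡ 0, so the nematic phase is a global minimiser. -/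
/-- In the regime `A < 0 ≤ a`, the one-dimensional modified Landau–de Gennes
energy with coupling term `B₀(u″ + q²(Q/s₊ + 1/2)u)²`, where `s₊ = √(−2A/C)`,
satisfies `E₁D(Q,u) ≥ −h·A²/(4C)` for all `C¹` functions `Q` and `C²`
functions `u`, with equality for the nematic phase `Q ≡ √(−A/(2C))`, `u ≡ 0`;
hence the nematic phase is a global minimiser. -/
theorem stmt_3 (h a c B₀ K C A q : ℝ) (hh : 0 < h) (ha : 0 ≤ a) (hc : 0 < c)
    (hB₀ : 0 < B₀) (hK : 0 < K) (hC : 0 < C) (hA : A < 0) :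
    (∀ Q u : ℝ → ℝ, ContDiff ℝ 1 Q → ContDiff ℝ 2 u →
      (∫ x in (0:ℝ)..h,
        (a / 2 * u x ^ 2 + c / 4 * u x ^ 4
          + B₀ * (iteratedDeriv 2 u x
              + q ^ 2 * (Q x / Real.sqrt (-2 * A / C) + 1 / 2) * u x) ^ 2
          + K * (deriv Q x) ^ 2 + A * Q x ^ 2 + C * Q x ^ 4))
        ≥ -(h * A ^ 2 / (4 * C))) ∧
    (∫ x in (0:ℝ)..h,
        (a / 2 * ((fun _ : ℝ => (0:ℝ)) x) ^ 2
          + c / 4 * ((fun _ : ℝ => (0:ℝ)) x) ^ 4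
          + B₀ * (iteratedDeriv 2 (fun _ : ℝ => (0:ℝ)) x
              + q ^ 2 * ((fun _ : ℝ => Real.sqrt (-A / (2 * C))) x
                  / Real.sqrt (-2 * A / C) + 1 / 2) * ((fun _ : ℝ => (0:ℝ)) x)) ^ 2
          + K * (deriv (fun _ : ℝ => Real.sqrt (-A / (2 * C))) x) ^ 2
          + A * ((fun _ : ℝ => Real.sqrt (-A / (2 * C))) x) ^ 2
          + C * ((fun _ : ℝ => Real.sqrt (-A / (2 * C))) x) ^ 4))
      = -(h * A ^ 2 / (4 * C)) := by
  refine ⟨?_, ?_⟩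
  · intro Q u hQ hu
    have hQc : Continuous Q := hQ.continuous
    have huc : Continuous u := hu.continuous
    have hQd : Continuous (deriv Q) := hQ.continuous_deriv le_rfl
    have hud : Continuous (iteratedDeriv 2 u) := hu.continuous_iteratedDeriv 2 le_rfl
    have hconst : (∫ _x in (0:ℝ)..h, -(A ^ 2 / (4 * C))) = -(h * A ^ 2 / (4 * C)) := by
      rw [intervalIntegral.integral_const, smul_eq_mul]
      ring
    rw [ge_iff_le, ← hconst]
    apply intervalIntegral.integral_mono_on hh.le
    · exact continuous_const.intervalIntegrable _ _
    · apply Continuous.intervalIntegrable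
      fun_prop
    · intro x _
      have h1 : 0 ≤ a / 2 * u x ^ 2 := by positivity
      have h2 : 0 ≤ c / 4 * u x ^ 4 := by positivity
      have h3 : 0 ≤ B₀ * (iteratedDeriv 2 u x
              + q ^ 2 * (Q x / Real.sqrt (-2 * A / C) + 1 / 2) * u x) ^ 2 := by positivity
      have h4 : 0 ≤ K * (deriv Q x) ^ 2 := by positivity
      have h5 : A * Q x ^ 2 + C * Q x ^ 4 + A ^ 2 / (4 * C)
          = C * (Q x ^ 2 + A / (2 * C)) ^ 2 := by
        field_simp
        ring
      have h6 : 0 ≤ C * (Q x ^ 2 + A / (2 * C)) ^ 2 := by positivity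
      linarith
  · have hs : Real.sqrt (-A / (2 * C)) ^ 2 = -A / (2 * C) :=
      Real.sq_sqrt (div_nonneg (by linarith) (by linarith))
    have hs4 : Real.sqrt (-A / (2 * C)) ^ 4 = (-A / (2 * C)) ^ 2 := by
      calc Real.sqrt (-A / (2 * C)) ^ 4 = (Real.sqrt (-A / (2 * C)) ^ 2) ^ 2 := by
            rw [← pow_mul]
        _ = (-A / (2 * C)) ^ 2 := by rw [hs]
    have h0 : ∀ x : ℝ, iteratedDeriv 2 (fun _ : ℝ => (0:ℝ)) x = 0 := by
      intro x
      simp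
    simp only [h0, deriv_const, hs, hs4]
    rw [intervalIntegral.integral_const, smul_eq_mul]
    field_simp
    ring
end

section
/- Let h > 0, let B₀ be a real number, let n₀ be a positive integer, set q = 2πn₀/h, and suppose a < 0. Then for η(x) = sin(qx), ∫₀ʰ [ a·η(x)² + 2B₀·(η″(x) + q²·η(x))² ] dx = a·h/2 < 0. In particular, the second variation of the one-dimensional energy at the nematic phase is negative along the direction (0, sin(qx)). -/
open Real

/-- Instability of the nematic phase for `a < 0`: with `q = 2πn₀/h`, the
second variation along `η(x) = sin(qx)` equals `a·h/2` and is negative. -/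
theorem stmt_6 (h B₀ a : ℝ) (hh : 0 < h) (n₀ : ℕ) (hn₀ : 0 < n₀)
    (ha : a < 0) :
    (∫ x in (0:ℝ)..h,
        (a * (Real.sin ((2 * π * n₀ / h) * x)) ^ 2
          + 2 * B₀ * (iteratedDeriv 2 (fun y => Real.sin ((2 * π * n₀ / h) * y)) x
              + (2 * π * n₀ / h) ^ 2 * Real.sin ((2 * π * n₀ / h) * x)) ^ 2))
      = a * h / 2 ∧ a * h / 2 < 0 := by
  refine ⟨?_, by nlinarith⟩
  have hn : (0:ℝ) < n₀ := by exact_mod_cast hn₀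
  have hq : (2 * π * n₀ / h) ≠ 0 := by positivity
  have hqh : (2 * π * n₀ / h) * h = n₀ * (2 * π) := by field_simp
  generalize (2 * π * n₀ / h) = q at hq hqh ⊢
  have h1 : deriv (fun y => Real.sin (q * y)) = fun y => q * Real.cos (q * y) := by
    funext y
    have := ((hasDerivAt_id y).const_mul q).sin
    simp only [id, mul_one] at this
    rw [this.deriv, mul_comm]
  have h2 : iteratedDeriv 2 (fun y => Real.sin (q * y))
      = fun y => -(q ^ 2 * Real.sin (q * y)) := by
    rw [iteratedDeriv_succ, iteratedDeriv_one, h1]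
    funext y
    have := (((hasDerivAt_id y).const_mul q).cos).const_mul q
    simp only [id, mul_one] at this
    rw [this.deriv]
    ring
  have hs : Real.sin (n₀ * (2 * π)) = 0 := by
    have := Real.sin_nat_mul_pi (n₀ * 2)
    push_cast at this
    rwa [mul_assoc] at this
  rw [h2]
  simp only [neg_add_cancel, ne_eq, OfNat.ofNat_ne_zero, not_false_eq_true, zero_pow, mul_zero,
    add_zero]
  rw [intervalIntegral.integral_const_mul,
    intervalIntegral.integral_comp_mul_left (fun y => Real.sin y ^ 2) hq, integral_sin_sq, hqh, hs,
    ← hqh]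
  simp only [mul_zero, Real.sin_zero, zero_mul, sub_zero, zero_add, smul_eq_mul]
  field_simp
end

section
/- Let h > 0, let n₀ be a positive integer, and set q = 2πn₀/h. Suppose w : [0,h] → ℝ is four-times continuously differentiable, satisfies w⁗(x) + 2q²·w″(x) + q⁴·w(x) = 0 on [0,h], and satisfies the boundary conditions w(0) = w(h) = 0, w′(0) = w′(h), and w″(0) = w″(h). Then there exists a real constant k₁ such that w(x) = k₁·sin(qx) for all x ∈ [0,h]. In particular, the solution space is one-dimensional. -/
open Real

/-- A function with zero derivative on `[0,h]` is constant there. -/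
lemma const_aux {h : ℝ} {f : ℝ → ℝ} (hf : ∀ x ∈ Set.Icc (0:ℝ) h, HasDerivAt f 0 x) :
    ∀ x ∈ Set.Icc (0:ℝ) h, f x = f 0 :=
  constant_of_has_deriv_right_zero
    (fun x hx => (hf x hx).continuousAt.continuousWithinAt)
    (fun x hx => (hf x (Set.Ico_subset_Icc_self hx)).hasDerivWithinAt)

lemma iter_aux {w : ℝ → ℝ} (hw : ContDiff ℝ 4 w) (n : ℕ) (hn : n < 4) (x : ℝ) :
    HasDerivAt (iteratedDeriv n w) (iteratedDeriv (n+1) w x) x := by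
  have hd : Differentiable ℝ (iteratedDeriv n w) :=
    hw.differentiable_iteratedDeriv n (by exact_mod_cast hn)
  rw [iteratedDeriv_succ]
  exact (hd x).hasDerivAt

/-- The core argument, with explicit derivatives. -/
lemma core_aux (h q : ℝ) (hh : 0 < h) (hq : 0 < q) (hs : sin (q * h) = 0) (hc : cos (q * h) = 1)
    (w w1 w2 w3 w4 : ℝ → ℝ)
    (h0 : ∀ x, HasDerivAt w (w1 x) x) (h1 : ∀ x, HasDerivAt w1 (w2 x) x)
    (h2 : ∀ x, HasDerivAt w2 (w3 x) x) (h3 : ∀ x, HasDerivAt w3 (w4 x) x)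
    (hode : ∀ x ∈ Set.Icc (0:ℝ) h, w4 x + 2 * q ^ 2 * w2 x + q ^ 4 * w x = 0)
    (hb0 : w 0 = 0) (hbh : w h = 0) (hb1 : w1 0 = w1 h) :
    ∃ k₁ : ℝ, ∀ x ∈ Set.Icc (0:ℝ) h, w x = k₁ * sin (q * x) := by
  have hS : ∀ x, HasDerivAt (fun x => sin (q * x)) (cos (q * x) * q) x := fun x => by
    simpa using ((hasDerivAt_id x).const_mul q).sin
  have hC : ∀ x, HasDerivAt (fun x => cos (q * x)) (-sin (q * x) * q) x := fun x => by
    simpa using ((hasDerivAt_id x).const_mul q).cos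
  have hg : ∀ x, HasDerivAt (fun x => w2 x + q ^ 2 * w x) (w3 x + q ^ 2 * w1 x) x := fun x =>
    (h2 x).add ((h0 x).const_mul _)
  have hg' : ∀ x, HasDerivAt (fun x => w3 x + q ^ 2 * w1 x) (w4 x + q ^ 2 * w2 x) x := fun x =>
    (h3 x).add ((h1 x).const_mul _)
  have hhmem : h ∈ Set.Icc (0:ℝ) h := ⟨hh.le, le_rfl⟩
  obtain ⟨P, hP⟩ : ∃ P, ∀ x ∈ Set.Icc (0:ℝ) h,
      (w3 x + q ^ 2 * w1 x) * cos (q * x) + q * ((w2 x + q ^ 2 * w x) * sin (q * x)) = P := by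
    refine ⟨_, const_aux (fun x hx => ?_)⟩
    refine (((hg' x).mul (hC x)).add (((hg x).mul (hS x)).const_mul q)).congr_deriv ?_
    linear_combination cos (q * x) * hode x hx
  obtain ⟨Q, hQ⟩ : ∃ Q, ∀ x ∈ Set.Icc (0:ℝ) h,
      (w3 x + q ^ 2 * w1 x) * sin (q * x) - q * ((w2 x + q ^ 2 * w x) * cos (q * x)) = Q := by
    refine ⟨_, const_aux (fun x hx => ?_)⟩
    refine (((hg' x).mul (hS x)).sub (((hg x).mul (hC x)).const_mul q)).congr_deriv ?_
    linear_combination sin (q * x) * hode x hx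
  have hgq : ∀ x ∈ Set.Icc (0:ℝ) h,
      q * (w2 x + q ^ 2 * w x) = P * sin (q * x) - Q * cos (q * x) := fun x hx => by
    linear_combination sin (q * x) * hP x hx - cos (q * x) * hQ x hx
      - q * (w2 x + q ^ 2 * w x) * sin_sq_add_cos_sq (q * x)
  have hA := const_aux (h := h) (f := fun x =>
      2 * q ^ 2 * (w1 x * cos (q * x) + q * (w x * sin (q * x)))
      - (P * (sin (q * x) * sin (q * x)) - Q * (q * x + sin (q * x) * cos (q * x))))
    (fun x hx => by
      refine (((((h1 x).mul (hC x)).add (((h0 x).mul (hS x)).const_mul q)).const_mul (2 * q ^ 2)).sub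
        ((((hS x).mul (hS x)).const_mul P).sub ((((hasDerivAt_id x).const_mul q).add
          ((hS x).mul (hC x))).const_mul Q))).congr_deriv ?_
      linear_combination 2 * q * cos (q * x) * hgq x hx - Q * q * sin_sq_add_cos_sq (q * x))
  have hB := const_aux (h := h) (f := fun x =>
      2 * q ^ 2 * (w1 x * sin (q * x) - q * (w x * cos (q * x)))
      - (P * (q * x - sin (q * x) * cos (q * x)) - Q * (sin (q * x) * sin (q * x))))
    (fun x hx => by
      refine (((((h1 x).mul (hS x)).sub (((h0 x).mul (hC x)).const_mul q)).const_mul (2 * q ^ 2)).sub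
        (((((hasDerivAt_id x).const_mul q).sub ((hS x).mul (hC x))).const_mul P).sub
          (((hS x).mul (hS x)).const_mul Q))).congr_deriv ?_
      linear_combination 2 * q * sin (q * x) * hgq x hx + P * q * sin_sq_add_cos_sq (q * x))
  have hqh : q * h ≠ 0 := by positivity
  have hQ0 : Q = 0 := by
    have := hA h hhmem
    simp only [hs, hc, hb0, hbh, ← hb1, mul_zero, sin_zero, cos_zero] at this
    have : Q * (q * h) = 0 := by linear_combination this
    exact (mul_eq_zero.1 this).resolve_right hqh
  have hP0 : P = 0 := by
    have := hB h hhmem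
    simp only [hs, hc, hb0, hbh, ← hb1, mul_zero, sin_zero, cos_zero] at this
    have : P * (q * h) = 0 := by linear_combination -this
    exact (mul_eq_zero.1 this).resolve_right hqh
  subst hQ0 hP0
  refine ⟨w1 0 / q, fun x hx => ?_⟩
  have a := hA x hx
  have b := hB x hx
  simp only [hb0, mul_zero, sin_zero, cos_zero] at a b
  have hq3 : 2 * q ^ 3 ≠ 0 := by positivity
  apply mul_left_cancel₀ hq3
  have e : 2 * q ^ 3 * (w1 0 / q * sin (q * x)) = 2 * q ^ 2 * (w1 0 * sin (q * x)) := by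
    field_simp
  rw [e]
  linear_combination sin (q * x) * a - cos (q * x) * b
    - 2 * q ^ 3 * w x * sin_sq_add_cos_sq (q * x)

/-- With `q = 2πn₀/h`, any `C⁴` solution of `w⁗ + 2q²w″ + q⁴w = 0` on `[0,h]`
satisfying `w(0) = w(h) = 0`, `w′(0) = w′(h)` and `w″(0) = w″(h)` is of the
form `w(x) = k₁·sin(qx)`; in particular the solution space is
one-dimensional. -/
theorem stmt_9 (h : ℝ) (hh : 0 < h) (n₀ : ℕ) (hn₀ : 0 < n₀) (w : ℝ → ℝ)
    (hw : ContDiff ℝ 4 w)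
    (hode : ∀ x ∈ Set.Icc (0:ℝ) h,
      iteratedDeriv 4 w x + 2 * (2 * π * n₀ / h) ^ 2 * iteratedDeriv 2 w x
        + (2 * π * n₀ / h) ^ 4 * w x = 0)
    (hb0 : w 0 = 0) (hbh : w h = 0)
    (hb1 : deriv w 0 = deriv w h)
    (hb2 : iteratedDeriv 2 w 0 = iteratedDeriv 2 w h) :
    ∃ k₁ : ℝ, ∀ x ∈ Set.Icc (0:ℝ) h,
      w x = k₁ * Real.sin ((2 * π * n₀ / h) * x) := by
  have hn : (0:ℝ) < n₀ := by exact_mod_cast hn₀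
  have e : 2 * π * n₀ / h * h = n₀ * (2 * π) := by field_simp
  have h0 := iter_aux hw 0 (by norm_num)
  rw [iteratedDeriv_zero] at h0
  refine core_aux h _ hh (by positivity) ?_ ?_ w _ _ _ _ h0 (iter_aux hw 1 (by norm_num))
    (iter_aux hw 2 (by norm_num)) (iter_aux hw 3 (by norm_num)) hode hb0 hbh ?_
  · rw [e]
    simpa using Real.sin_add_nat_mul_two_pi 0 n₀
  · rw [e]
    exact Real.cos_nat_mul_two_pi n₀
  · simpa [iteratedDeriv_one] using hb1
end

section
/- Let h > 0, let n₀ be a positive integer, set q = 2πn₀/h, and let B₀ ≠ 0. Then there is no four-times continuously differentiable function w : [0,h] → ℝ satisfying 2B₀·( w⁗(x) + 2q²·w″(x) + q⁴·w(x) ) = sin(qx) on [0,h] together with the boundary conditions w(0) = w(h) = 0, w′(0) = w′(h) = 0, and w″(0) = w″(h). -/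
open Real

/-- Transversality: with `q = 2πn₀/h` and `B₀ ≠ 0`, there is no `C⁴` function
`w` on `[0,h]` solving `2B₀(w⁗ + 2q²w″ + q⁴w) = sin(qx)` with boundary
conditions `w(0) = w(h) = 0`, `w′(0) = w′(h) = 0`, `w″(0) = w″(h)`; i.e.
`sin(qx)` is not in the range of the linearised operator. -/
theorem stmt_11 (h B₀ : ℝ) (hh : 0 < h) (n₀ : ℕ) (hn₀ : 0 < n₀)
    (hB₀ : B₀ ≠ 0) :
    ¬ ∃ w : ℝ → ℝ, ContDiff ℝ 4 w ∧
      (∀ x ∈ Set.Icc (0:ℝ) h,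
        2 * B₀ * (iteratedDeriv 4 w x
            + 2 * (2 * π * n₀ / h) ^ 2 * iteratedDeriv 2 w x
            + (2 * π * n₀ / h) ^ 4 * w x)
          = Real.sin ((2 * π * n₀ / h) * x)) ∧
      w 0 = 0 ∧ w h = 0 ∧ deriv w 0 = 0 ∧ deriv w h = 0 ∧
      iteratedDeriv 2 w 0 = iteratedDeriv 2 w h := by
  rintro ⟨w, hw, hode, hw0, hwh, hd0, hdh, hdd⟩
  have hq : 2 * π * n₀ / h ≠ 0 := by
    have : (0:ℝ) < n₀ := by exact_mod_cast hn₀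
    positivity
  have hqh : 2 * π * n₀ / h * h = n₀ * (2 * π) := by field_simp
  generalize 2 * π * n₀ / h = q at *
  have hD : ∀ k : ℕ, k < 4 → ∀ x,
      HasDerivAt (iteratedDeriv k w) (iteratedDeriv (k + 1) w x) x := by
    intro k hk x
    rw [iteratedDeriv_succ]
    exact ((hw.differentiable_iteratedDeriv k (by exact_mod_cast hk)) x).hasDerivAt
  have h0 := hD 0 (by norm_num)
  have h1 := hD 1 (by norm_num)
  have h2 := hD 2 (by norm_num)
  have h3 := hD 3 (by norm_num)
  simp only [iteratedDeriv_zero, zero_add, Nat.reduceAdd] at h0 h1 h2 h3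
  rw [← iteratedDeriv_one] at hd0 hdh
  have hs : ∀ x, HasDerivAt (fun x => Real.sin (q * x)) (q * Real.cos (q * x)) x := by
    intro x
    have := ((hasDerivAt_id x).const_mul q).sin
    simpa [mul_comm] using this
  have hc : ∀ x, HasDerivAt (fun x => Real.cos (q * x)) (-(q * Real.sin (q * x))) x := by
    intro x
    have := ((hasDerivAt_id x).const_mul q).cos
    simpa [mul_comm] using this
  let F : ℝ → ℝ := fun x => 2 * B₀ * (Real.sin (q * x) * iteratedDeriv 3 w x
    - q * (Real.cos (q * x) * iteratedDeriv 2 w x)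
    + q ^ 2 * (Real.sin (q * x) * iteratedDeriv 1 w x)
    - q ^ 3 * (Real.cos (q * x) * w x))
    + (1 / (2 * q)) * (Real.sin (q * x) * Real.cos (q * x)) - (1 / 2) * x
  have hF : ∀ x ∈ Set.Icc (0:ℝ) h, HasDerivAt F 0 x := by
    intro x hx
    have key := ((((((((hs x).mul (h3 x)).sub (((hc x).mul (h2 x)).const_mul q)).add
      (((hs x).mul (h1 x)).const_mul (q ^ 2))).sub
      (((hc x).mul (h0 x)).const_mul (q ^ 3))).const_mul (2 * B₀)).add
      (((hs x).mul (hc x)).const_mul (1 / (2 * q)))).sub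
      ((hasDerivAt_id x).const_mul (1 / 2)))
    refine key.congr_deriv ?_
    have e := hode x hx
    have sc := Real.sin_sq_add_cos_sq (q * x)
    have e2 : 1 / (2 * q) * (q * Real.cos (q * x) * Real.cos (q * x)
        + Real.sin (q * x) * -(q * Real.sin (q * x)))
        = (Real.cos (q * x) ^ 2 - Real.sin (q * x) ^ 2) / 2 := by
      field_simp
      ring
    rw [e2]
    linear_combination Real.sin (q * x) * e + (1 / 2) * sc
  obtain ⟨c, -, hc'⟩ := exists_hasDerivAt_eq_slope F (fun _ => 0) hh
    (fun x hx => (hF x hx).continuousAt.continuousWithinAt)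
    (fun x hx => hF x ⟨hx.1.le, hx.2.le⟩)
  have sh : Real.sin (n₀ * (2 * π)) = 0 := by
    have := Real.sin_nat_mul_pi (n₀ * 2)
    push_cast at this
    rwa [mul_assoc] at this
  have ch : Real.cos (n₀ * (2 * π)) = 1 := Real.cos_nat_mul_two_pi n₀
  have : F h - F 0 = -(1 / 2) * h := by
    simp only [F, hqh, sh, ch, mul_zero, Real.sin_zero, Real.cos_zero, hw0, hwh, hdd]
    ring
  rw [this] at hc'
  field_simp at hc'
  norm_num at hc'
  exact hh.ne' hc'
end

section
/- Let Ω ⊆ ℝ² be a nonempty open connected set, let q ≠ 0 be a real number, and let u : Ω → ℝ be three-times continuously differentiable. Suppose that at every point of Ω the Hessian of u satisfies D²u = −(q²/2)·u·I₂, i.e. ∂²u/∂x∂y = 0 and ∂²u/∂x² = ∂²u/∂y² = −(q²/2)·u. Then u ≡ 0 on Ω. -/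
/-- Near a nematic defect the coupling energy forces `u ≡ 0`: if `u` is `C³`
on a nonempty open connected set `Ω ⊆ ℝ²` and its Hessian satisfies
`D²u = −(q²/2)·u·I₂` on `Ω` (i.e. `u_xy = 0`, `u_xx = u_yy = −(q²/2)u`) with
`q ≠ 0`, then `u` vanishes identically on `Ω`. -/
theorem stmt_15 (Ω : Set (ℝ × ℝ)) (hΩo : IsOpen Ω) (hΩc : IsConnected Ω)
    (q : ℝ) (hq : q ≠ 0) (u : ℝ × ℝ → ℝ) (hu : ContDiffOn ℝ 3 u Ω)
    (hxy : ∀ p ∈ Ω,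
      deriv (fun s => deriv (fun t => u (s, t)) p.2) p.1 = 0)
    (hxx : ∀ p ∈ Ω,
      deriv (fun s => deriv (fun s' => u (s', p.2)) s) p.1 = -(q ^ 2 / 2) * u p)
    (hyy : ∀ p ∈ Ω,
      deriv (fun t => deriv (fun t' => u (p.1, t')) t) p.2 = -(q ^ 2 / 2) * u p) :
    ∀ p ∈ Ω, u p = 0 := by
  rintro ⟨a, b⟩ hp
  obtain ⟨r, hr, hball⟩ := Metric.isOpen_iff.1 hΩo (a, b) hp
  have hbox : ∀ s ∈ Metric.ball a r, ∀ t ∈ Metric.ball b r, (s, t) ∈ Ω := by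
    intro s hs t ht
    apply hball
    rw [← ball_prod_same]
    exact ⟨hs, ht⟩
  have ha : a ∈ Metric.ball a r := Metric.mem_ball_self hr
  have hb : b ∈ Metric.ball b r := Metric.mem_ball_self hr
  have hc : -(q ^ 2 / 2) ≠ 0 := by
    have : q ^ 2 ≠ 0 := pow_ne_zero 2 hq
    intro h
    apply this
    linarith
  -- the partial derivative in the second variable is a directional Fréchet derivative
  have hg : ∀ s t, (s, t) ∈ Ω →
      deriv (fun t => u (s, t)) t = fderiv ℝ u (s, t) (0, 1) := by
    intro s t h
    have h1 : HasFDerivAt u (fderiv ℝ u (s, t)) (s, t) :=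
      ((hu.contDiffAt (hΩo.mem_nhds h)).differentiableAt (by norm_num)).hasFDerivAt
    have h2 : HasDerivAt (fun t : ℝ => (s, t)) ((0 : ℝ), (1 : ℝ)) t :=
      (hasDerivAt_const t s).prodMk (hasDerivAt_id t)
    exact (h1.comp_hasDerivAt t h2).deriv
  have hdiff : ∀ s t, (s, t) ∈ Ω →
      DifferentiableAt ℝ (fun s => deriv (fun t => u (s, t)) t) s := by
    intro s t h
    have h1 : DifferentiableAt ℝ (fderiv ℝ u) (s, t) :=
      ((hu.contDiffAt (hΩo.mem_nhds h)).fderiv_right (m := 2) (by norm_num)).differentiableAt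
        (by norm_num)
    have h2 : DifferentiableAt ℝ (fun s : ℝ => (s, t)) s := by fun_prop
    have h3 : DifferentiableAt ℝ (fun s : ℝ => fderiv ℝ u (s, t) (0, 1)) s :=
      (DifferentiableAt.comp (g := fderiv ℝ u) s h1 h2).clm_apply
        (differentiableAt_const _)
    refine h3.congr_of_eventuallyEq ?_
    have h4 : ∀ᶠ s' in nhds s, (s', t) ∈ Ω :=
      h2.continuousAt.eventually_mem (hΩo.mem_nhds h)
    filter_upwards [h4] with s' hs'
    exact hg s' t hs'
  have hconst : ∀ s ∈ Metric.ball a r, ∀ t ∈ Metric.ball b r,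
      deriv (fun t => u (s, t)) t = deriv (fun t => u (a, t)) t := by
    intro s hs t ht
    refine Metric.isOpen_ball.is_const_of_deriv_eq_zero
      (f := fun s => deriv (fun t => u (s, t)) t)
      (convex_ball a r).isPreconnected ?_ ?_ hs ha
    · intro s' hs'
      exact (hdiff s' t (hbox s' hs' t ht)).differentiableWithinAt
    · intro s' hs'
      exact hxy (s', t) (hbox s' hs' t ht)
  have hu_const : ∀ s ∈ Metric.ball a r, u (s, b) = u (a, b) := by
    intro s hs
    have h1 := hyy (s, b) (hbox s hs b hb)
    have h2 := hyy (a, b) hp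
    have h3 : (fun t => deriv (fun t' => u (s, t')) t) =ᶠ[nhds b]
        (fun t => deriv (fun t' => u (a, t')) t) := by
      filter_upwards [Metric.isOpen_ball.mem_nhds hb] with t ht
      exact hconst s hs t ht
    have h4 := h3.deriv_eq
    simp only at h1 h2
    rw [h1, h2] at h4
    exact mul_left_cancel₀ hc h4
  have h5 : (fun s => u (s, b)) =ᶠ[nhds a] (fun _ => u (a, b)) := by
    filter_upwards [Metric.isOpen_ball.mem_nhds ha] with s hs
    exact hu_const s hs
  have h6 := hxx (a, b) hp
  have h7 := h5.deriv.deriv_eq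
  simp only [deriv_const', deriv_const] at h6 h7
  have h8 : -(q ^ 2 / 2) * u (a, b) = 0 := by
    rw [← h6]
    exact h7
  exact (mul_eq_zero.1 h8).resolve_left hc
end

section
/- Let a < 0, c > 0, B₀ > 0, q > 0, and let n ∈ ℝ² be a unit vector. Define, for A₀ ∈ ℝ, q̃ > 0 and unit vectors k ∈ ℝ², F(A₀, q̃, k) = a·A₀² + (3c/8)·A₀⁴ + 2B₀·A₀²·| q²·n nᵀ − q̃²·k kᵀ |², where |·| is the Frobenius norm. Then F(A₀, q̃, k) ≥ −2a²/(3c) for all admissible arguments, and equality holds if and only if A₀² = −4a/(3c), q̃ = q, and k = n or k = −n. -/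
/-- The squared Frobenius norm of a 2×2 real matrix. -/
def frobSq (M : Matrix (Fin 2) (Fin 2) ℝ) : ℝ := ∑ i, ∑ j, (M i j) ^ 2

lemma frobSq_form (q qt : ℝ) (n k : Fin 2 → ℝ) :
    frobSq (q ^ 2 • Matrix.vecMulVec n n - qt ^ 2 • Matrix.vecMulVec k k) =
      (q ^ 2 * (n 0 * n 0) - qt ^ 2 * (k 0 * k 0)) ^ 2
      + (q ^ 2 * (n 0 * n 1) - qt ^ 2 * (k 0 * k 1)) ^ 2
      + ((q ^ 2 * (n 1 * n 0) - qt ^ 2 * (k 1 * k 0)) ^ 2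
      + (q ^ 2 * (n 1 * n 1) - qt ^ 2 * (k 1 * k 1)) ^ 2) := by
  simp [frobSq, Fin.sum_univ_two, Matrix.vecMulVec_apply]

lemma frobSq_zero (q qt : ℝ) (hq : 0 < q) (hqt : 0 < qt) (n k : Fin 2 → ℝ)
    (hn : n 0 ^ 2 + n 1 ^ 2 = 1) (hk : k 0 ^ 2 + k 1 ^ 2 = 1)
    (h : frobSq (q ^ 2 • Matrix.vecMulVec n n - qt ^ 2 • Matrix.vecMulVec k k) = 0) :
    qt = q ∧ (k = n ∨ k = -n) := by
  rw [frobSq_form] at h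
  have e1 : q ^ 2 * (n 0 * n 0) - qt ^ 2 * (k 0 * k 0) = 0 := by
    apply pow_eq_zero_iff (two_ne_zero) |>.1; apply le_antisymm _ (sq_nonneg _)
    rw [← h]; linarith [sq_nonneg (q ^ 2 * (n 0 * n 1) - qt ^ 2 * (k 0 * k 1)), sq_nonneg (q ^ 2 * (n 1 * n 0) - qt ^ 2 * (k 1 * k 0)), sq_nonneg (q ^ 2 * (n 1 * n 1) - qt ^ 2 * (k 1 * k 1))]
  have e2 : q ^ 2 * (n 0 * n 1) - qt ^ 2 * (k 0 * k 1) = 0 := by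
    apply pow_eq_zero_iff (two_ne_zero) |>.1; apply le_antisymm _ (sq_nonneg _)
    rw [← h]; linarith [sq_nonneg (q ^ 2 * (n 0 * n 0) - qt ^ 2 * (k 0 * k 0)), sq_nonneg (q ^ 2 * (n 1 * n 0) - qt ^ 2 * (k 1 * k 0)), sq_nonneg (q ^ 2 * (n 1 * n 1) - qt ^ 2 * (k 1 * k 1))]
  have e3 : q ^ 2 * (n 1 * n 1) - qt ^ 2 * (k 1 * k 1) = 0 := by
    apply pow_eq_zero_iff (two_ne_zero) |>.1; apply le_antisymm _ (sq_nonneg _)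
    rw [← h]; linarith [sq_nonneg (q ^ 2 * (n 0 * n 0) - qt ^ 2 * (k 0 * k 0)), sq_nonneg (q ^ 2 * (n 1 * n 0) - qt ^ 2 * (k 1 * k 0)), sq_nonneg (q ^ 2 * (n 0 * n 1) - qt ^ 2 * (k 0 * k 1))]
  have e4 : qt ^ 2 = q ^ 2 := by linear_combination q ^ 2 * hn - qt ^ 2 * hk - e1 - e3
  have e5 : qt = q := (pow_left_inj₀ hqt.le hq.le two_ne_zero).1 e4
  subst e5
  refine ⟨rfl, ?_⟩
  have hne : qt ^ 2 ≠ 0 := by positivity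
  have f1 : n 0 * n 0 = k 0 * k 0 := mul_left_cancel₀ hne (sub_eq_zero.1 e1)
  have f2 : n 0 * n 1 = k 0 * k 1 := mul_left_cancel₀ hne (sub_eq_zero.1 e2)
  have f3 : n 1 * n 1 = k 1 * k 1 := mul_left_cancel₀ hne (sub_eq_zero.1 e3)
  have hd : (k 0 * n 0 + k 1 * n 1) ^ 2 = 1 := by
    have : (k 0 * n 0 + k 1 * n 1) ^ 2 = (n 0 ^ 2 + n 1 ^ 2) ^ 2 := by
      linear_combination (-(n 0 * n 0)) * f1 - 2 * (n 0 * n 1) * f2 - (n 1 * n 1) * f3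
    rw [this, hn]; norm_num
  rcases (sq_eq_sq_iff_eq_or_eq_neg.1 (hd.trans (one_pow 2).symm)) with h1 | h1
  · left
    have z : (k 0 - n 0) ^ 2 + (k 1 - n 1) ^ 2 = 0 := by linear_combination hn + hk - 2 * h1
    ext i
    fin_cases i
    · show k 0 = n 0
      nlinarith [sq_nonneg (k 0 - n 0), sq_nonneg (k 1 - n 1)]
    · show k 1 = n 1
      nlinarith [sq_nonneg (k 0 - n 0), sq_nonneg (k 1 - n 1)]
  · right
    have z : (k 0 + n 0) ^ 2 + (k 1 + n 1) ^ 2 = 0 := by linear_combination hn + hk + 2 * h1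
    ext i
    fin_cases i
    · show k 0 = - n 0
      nlinarith [sq_nonneg (k 0 + n 0), sq_nonneg (k 1 + n 1)]
    · show k 1 = - n 1
      nlinarith [sq_nonneg (k 0 + n 0), sq_nonneg (k 1 + n 1)]

/-- Large-domain limit: for `a < 0 < c`, `B₀ > 0`, `q > 0` and a unit vector
`n ∈ ℝ²`, the reduced energy
`F(A₀,q̃,k) = a·A₀² + (3c/8)·A₀⁴ + 2B₀·A₀²·|q²·n nᵀ − q̃²·k kᵀ|²`
satisfies `F ≥ −2a²/(3c)`, with equality iff `A₀² = −4a/(3c)`, `q̃ = q` and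
`k = ±n`. -/
theorem stmt_17 (a c B₀ q : ℝ) (ha : a < 0) (hc : 0 < c) (hB₀ : 0 < B₀)
    (hq : 0 < q) (n : Fin 2 → ℝ) (hn : n 0 ^ 2 + n 1 ^ 2 = 1) :
    ∀ (A₀ qt : ℝ) (k : Fin 2 → ℝ), 0 < qt → k 0 ^ 2 + k 1 ^ 2 = 1 →
      (a * A₀ ^ 2 + 3 * c / 8 * A₀ ^ 4
          + 2 * B₀ * A₀ ^ 2 *
            frobSq (q ^ 2 • Matrix.vecMulVec n n - qt ^ 2 • Matrix.vecMulVec k k)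
        ≥ -(2 * a ^ 2 / (3 * c))) ∧
      (a * A₀ ^ 2 + 3 * c / 8 * A₀ ^ 4
          + 2 * B₀ * A₀ ^ 2 *
            frobSq (q ^ 2 • Matrix.vecMulVec n n - qt ^ 2 • Matrix.vecMulVec k k)
        = -(2 * a ^ 2 / (3 * c)) ↔
        A₀ ^ 2 = -(4 * a) / (3 * c) ∧ qt = q ∧ (k = n ∨ k = -n)) := by
  intro A₀ qt k hqt hk
  have hS0 : 0 ≤ frobSq (q ^ 2 • Matrix.vecMulVec n n - qt ^ 2 • Matrix.vecMulVec k k) := by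
    rw [frobSq_form]; positivity
  have hSz := frobSq_zero q qt hq hqt n k hn hk
  have hSz' : qt = q → (k = n ∨ k = -n) →
      frobSq (q ^ 2 • Matrix.vecMulVec n n - qt ^ 2 • Matrix.vecMulVec k k) = 0 := by
    rintro rfl (rfl | rfl) <;> rw [frobSq_form] <;> simp
  generalize frobSq (q ^ 2 • Matrix.vecMulVec n n - qt ^ 2 • Matrix.vecMulVec k k) = S at *
  have key : a * A₀ ^ 2 + 3 * c / 8 * A₀ ^ 4 + 2 * B₀ * A₀ ^ 2 * S =
      -(2 * a ^ 2 / (3 * c)) + (3 * c / 8 * (A₀ ^ 2 - -(4 * a) / (3 * c)) ^ 2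
        + 2 * B₀ * A₀ ^ 2 * S) := by
    field_simp
    ring
  have p1 : 0 ≤ 3 * c / 8 * (A₀ ^ 2 - -(4 * a) / (3 * c)) ^ 2 := by positivity
  have p2 : 0 ≤ 2 * B₀ * A₀ ^ 2 * S := by positivity
  rw [key]
  refine ⟨by linarith, ?_, ?_⟩
  · intro h
    have z1 : 3 * c / 8 * (A₀ ^ 2 - -(4 * a) / (3 * c)) ^ 2 = 0 := by linarith
    have z2 : 2 * B₀ * A₀ ^ 2 * S = 0 := by linarith
    have hA : A₀ ^ 2 = -(4 * a) / (3 * c) := by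
      have hc' : 3 * c / 8 ≠ 0 := by positivity
      have := (mul_eq_zero.1 z1).resolve_left hc'
      exact sub_eq_zero.1 ((pow_eq_zero_iff two_ne_zero).1 this)
    have hpos : 0 < A₀ ^ 2 := by
      rw [hA]; apply div_pos <;> linarith
    have hne : 2 * B₀ * A₀ ^ 2 ≠ 0 := by positivity
    exact ⟨hA, hSz ((mul_eq_zero.1 z2).resolve_left hne)⟩
  · rintro ⟨hA, h1, h2⟩
    rw [hSz' h1 h2, hA]
    ring
end
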